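/- Let 1<p₁,p₂<∞ and 0<α<2n. Let b be a real-valued BMO function, let Q_j be a cube with center y_j, and let f_j and g_j be the associated test functions (in particular f_j has mean zero). Then for all x outside the cube 2√n·Q_j (the cube concentric with Q_j with side length 2√n times that of Q_j), |I_α(f_j, g_j)(x)| ≤ C |Q_j|^{1/p₁' + 1/p₂' + 1/n} |x−y_j|^{−2n+α−1}, where C is independent of b, Q_j, and x. -/

import Mathlib

open MeasureTheory Set Filter
open scoped ENNReal BigOperators Topology

noncomputable section

/-- Euclidean space `ℝⁿ`. -/
abbrev Rn (n : ℕ) : Type := EuclideanSpace ℝ (Fin n)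

/-- The closed axis-parallel cube with center `c` and side length `d`. -/
def cube (n : ℕ) (c : Rn n) (d : ℝ) : Set (Rn n) :=
  {x | ∀ i : Fin n, |x i - c i| ≤ d / 2}

/-- The average `b_Q` of `b` over the cube with center `c` and side length `d`. -/
def cubeAvg (n : ℕ) (b : Rn n → ℝ) (c : Rn n) (d : ℝ) : ℝ :=
  ⨍ x in cube n c d, b x

/-- The mean oscillation `⨍_Q |b - b_Q|` of `b` over a cube. -/
def osc (n : ℕ) (b : Rn n → ℝ) (c : Rn n) (d : ℝ) : ℝ :=
  ⨍ x in cube n c d, |b x - cubeAvg n b c d|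

/-- The BMO seminorm: supremum of mean oscillations over all axis-parallel cubes. -/
def bmoNorm (n : ℕ) (b : Rn n → ℝ) : ℝ :=
  ⨆ cd : Rn n × {d : ℝ // 0 < d}, osc n b cd.1 cd.2.1

/-- `b ∈ CMO`: `b` belongs to the closure of `C_c^∞` in the BMO seminorm. -/
def MemCMO (n : ℕ) (b : Rn n → ℝ) : Prop :=
  ∀ ε : ℝ, 0 < ε → ∃ φ : Rn n → ℝ, ContDiff ℝ (⊤ : ℕ∞) φ ∧ HasCompactSupport φ ∧
    bmoNorm n (b - φ) < ε

/-- The conjugate exponent `p' = p/(p-1)`. -/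
def conjExp (p : ℝ) : ℝ := p / (p - 1)

/-- The Muckenhoupt class `A_p`. -/
def MuckenhouptAp (n : ℕ) (p : ℝ) (w : Rn n → ℝ) : Prop :=
  (∀ x, 0 ≤ w x) ∧ LocallyIntegrable w volume ∧
  ∃ C : ℝ, ∀ (c : Rn n) (d : ℝ), 0 < d →
    (⨍ x in cube n c d, w x) *
      (⨍ x in cube n c d, w x ^ (1 - conjExp p)) ^ (p / conjExp p) ≤ C

/-- The `A_p` characteristic constant `[w]_{A_p}`. -/
def apConst (n : ℕ) (p : ℝ) (w : Rn n → ℝ) : ℝ :=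
  ⨆ cd : Rn n × {d : ℝ // 0 < d},
    (⨍ x in cube n cd.1 cd.2.1, w x) *
      (⨍ x in cube n cd.1 cd.2.1, w x ^ (1 - conjExp p)) ^ (p / conjExp p)

/-- The bilinear class `A_{P,q}` for `P = (p₁,p₂)`. -/
def MuckenhouptAPq (n : ℕ) (p₁ p₂ q : ℝ) (w₁ w₂ : Rn n → ℝ) : Prop :=
  ∃ C : ℝ, ∀ (c : Rn n) (d : ℝ), 0 < d →
    (⨍ x in cube n c d, (w₁ x * w₂ x) ^ q) *
      (⨍ x in cube n c d, w₁ x ^ (-(conjExp p₁))) ^ (q / conjExp p₁) *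
      (⨍ x in cube n c d, w₂ x ^ (-(conjExp p₂))) ^ (q / conjExp p₂) ≤ C

/-- The kernel of the bilinear fractional integral `I_α`. -/
def fracKernel (n : ℕ) (α : ℝ) (x y z : Rn n) : ℝ :=
  (‖x - y‖ ^ 2 + ‖x - z‖ ^ 2) ^ (-((n : ℝ) - α / 2))

/-- The bilinear fractional integral operator `I_α`. -/
def Iop (n : ℕ) (α : ℝ) (f g : Rn n → ℝ) (x : Rn n) : ℝ :=
  ∫ y, ∫ z, fracKernel n α x y z * (f y * g z)

/-- The first commutator `[b, I_α]₁(f,g) = I_α(bf, g) - b · I_α(f,g)`. -/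
def commI (n : ℕ) (α : ℝ) (b f g : Rn n → ℝ) : Rn n → ℝ :=
  fun x => Iop n α (fun y => b y * f y) g x - b x * Iop n α f g x

/-- The weighted Lᵖ norm `(∫ |f|^p w)^{1/p}` (with value in `ℝ≥0∞`). -/
def wNorm (n : ℕ) (p : ℝ) (w : Rn n → ℝ) (f : Rn n → ℝ) : ℝ≥0∞ :=
  (∫⁻ x, ENNReal.ofReal (|f x| ^ p * w x)) ^ (1 / p)

/-- A bilinear operator `T` is compact from `L^{p₁}(w₁) × L^{p₂}(w₂)` to `L^q(μ)` when the
image of the product of unit balls is precompact in `L^q(μ)`; equivalently (by completeness),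
every sequence in the image of the unit balls admits a subsequence which is Cauchy for the
`L^q(μ)` norm. -/
def BilinCompact (n : ℕ) (p₁ p₂ q : ℝ) (w₁ w₂ μ : Rn n → ℝ)
    (T : (Rn n → ℝ) → (Rn n → ℝ) → Rn n → ℝ) : Prop :=
  ∀ F G : ℕ → Rn n → ℝ,
    (∀ j, wNorm n p₁ w₁ (F j) ≤ 1) → (∀ j, wNorm n p₂ w₂ (G j) ≤ 1) →
    ∃ φ : ℕ → ℕ, StrictMono φ ∧
      ∀ ε : ℝ, 0 < ε → ∃ N : ℕ, ∀ j ≥ N, ∀ k ≥ N,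
        wNorm n q μ (fun x => T (F (φ j)) (G (φ j)) x - T (F (φ k)) (G (φ k)) x)
          < ENNReal.ofReal ε

/-- The smoothly truncated kernel `K^δ` with implicit constant `A`. -/
def IsTruncKernel (n : ℕ) (α δ A : ℝ) (K : Rn n → Rn n → Rn n → ℝ) : Prop :=
  ContDiff ℝ 1 (fun pt : Rn n × Rn n × Rn n => K pt.1 pt.2.1 pt.2.2) ∧
  (∀ x y z, 2 * δ < max ‖x - y‖ ‖x - z‖ → K x y z = fracKernel n α x y z) ∧
  (∀ x y z, max ‖x - y‖ ‖x - z‖ < δ → K x y z = 0) ∧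
  (∀ x y z : Rn n, |K x y z| ≤ A * (‖x - y‖ + ‖x - z‖) ^ (-(2 * (n : ℝ) - α))) ∧
  (∀ x y z : Rn n,
    ‖fderiv ℝ (fun pt : Rn n × Rn n × Rn n => K pt.1 pt.2.1 pt.2.2) (x, y, z)‖ ≤
      A * (‖x - y‖ + ‖x - z‖) ^ (-(2 * (n : ℝ) - α - 1)))

/-- The bilinear operator with kernel `K`. -/
def IopK (n : ℕ) (K : Rn n → Rn n → Rn n → ℝ) (f g : Rn n → ℝ) (x : Rn n) : ℝ :=
  ∫ y, ∫ z, K x y z * (f y * g z)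

/-- The first commutator of the truncated operator. -/
def commIK (n : ℕ) (K : Rn n → Rn n → Rn n → ℝ) (b f g : Rn n → ℝ) : Rn n → ℝ :=
  fun x => IopK n K (fun y => b y * f y) g x - b x * IopK n K f g x

/-- The bilinear fractional maximal function `M_α`. -/
def Mmax (n : ℕ) (α : ℝ) (f g : Rn n → ℝ) (x : Rn n) : ℝ :=
  ⨆ cd : {cd : Rn n × ℝ // 0 < cd.2 ∧ x ∈ cube n cd.1 cd.2},
    ((cd : Rn n × ℝ).2 ^ n) ^ (α / n) *
      ((⨍ y in cube n (cd : Rn n × ℝ).1 (cd : Rn n × ℝ).2, |f y|) *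
        (⨍ z in cube n (cd : Rn n × ℝ).1 (cd : Rn n × ℝ).2, |g z|))

/-- The test function `f_j` associated to the cube with center `c`, side `d` and symbol `b`:
`f_j = |Q|^{-1/p₁} (sgn(b - b_Q) - c₀) χ_Q` where `c₀ = ⨍_Q sgn(b - b_Q)`. -/
def testF (n : ℕ) (p₁ : ℝ) (b : Rn n → ℝ) (c : Rn n) (d : ℝ) : Rn n → ℝ :=
  indicator (cube n c d) fun y =>
    (d ^ n) ^ (-(1 / p₁)) *
      (Real.sign (b y - cubeAvg n b c d) -
        ⨍ z in cube n c d, Real.sign (b z - cubeAvg n b c d))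

/-- The test function `g_j = |Q|^{-1/p₂} χ_Q` associated to the cube with center `c`, side `d`. -/
def testG (n : ℕ) (p₂ : ℝ) (c : Rn n) (d : ℝ) : Rn n → ℝ :=
  indicator (cube n c d) fun _ => (d ^ n) ^ (-(1 / p₂))

end

lemma cube_eq_preimage (n : ℕ) (c : Rn n) (d : ℝ) :
    cube n c d = (WithLp.ofLp) ⁻¹' (Set.Icc (fun i => c i - d / 2) (fun i => c i + d / 2)) := by
  ext x
  simp only [cube, Set.mem_setOf_eq, Set.mem_preimage, Set.mem_Icc, Pi.le_def, abs_le]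
  constructor
  · intro h
    exact ⟨fun i => by linarith [(h i).1], fun i => by linarith [(h i).2]⟩
  · intro h i
    exact ⟨by linarith [h.1 i], by linarith [h.2 i]⟩

lemma measurableSet_cube (n : ℕ) (c : Rn n) (d : ℝ) : MeasurableSet (cube n c d) := by
  rw [cube_eq_preimage]
  exact (PiLp.volume_preserving_ofLp (Fin n)).measurable measurableSet_Icc

lemma volume_cube (n : ℕ) (c : Rn n) (d : ℝ) (hd : 0 < d) :
    volume (cube n c d) = ENNReal.ofReal (d ^ n) := by
  rw [cube_eq_preimage, (PiLp.volume_preserving_ofLp (Fin n)).measure_preimage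
    measurableSet_Icc.nullMeasurableSet, Real.volume_Icc_pi]
  have : ∀ i : Fin n, c i + d / 2 - (c i - d / 2) = d := fun i => by ring
  simp only [this, Finset.prod_const, Finset.card_univ, Fintype.card_fin]
  rw [ENNReal.ofReal_pow hd.le]

lemma norm_sub_le_of_mem_cube (n : ℕ) (c : Rn n) (d : ℝ) (hd : 0 < d) (y : Rn n)
    (hy : y ∈ cube n c d) : ‖y - c‖ ≤ √n * d / 2 := by
  rw [EuclideanSpace.norm_eq]
  have h1 : ∑ i, ‖(y - c) i‖ ^ 2 ≤ ∑ i : Fin n, (d / 2) ^ 2 := by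
    apply Finset.sum_le_sum
    intro i _
    have := hy i
    simp only [PiLp.sub_apply, Real.norm_eq_abs]
    gcongr
  calc _ ≤ √(∑ i : Fin n, (d / 2) ^ 2) := Real.sqrt_le_sqrt h1
    _ = √n * d / 2 := by
      simp only [Finset.sum_const, Finset.card_univ, Fintype.card_fin, nsmul_eq_mul]
      rw [Real.sqrt_mul (by positivity), Real.sqrt_sq (by positivity)]
      ring

lemma lt_norm_of_notMem_cube (n : ℕ) (c : Rn n) (d : ℝ) (x : Rn n)
    (hx : x ∉ cube n c (2 * √n * d)) : √n * d < ‖x - c‖ := by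
  simp only [cube, Set.mem_setOf_eq, not_forall, not_le] at hx
  obtain ⟨i, hi⟩ := hx
  have := PiLp.norm_apply_le (x - c) i
  simp only [PiLp.sub_apply, Real.norm_eq_abs] at this
  linarith

lemma rpow_lip (β m s t : ℝ) (hβ : 0 < β) (hm : 0 < m) (hs : m ≤ s) (ht : m ≤ t) :
    |s ^ (-β) - t ^ (-β)| ≤ β * m ^ (-β - 1) * |s - t| := by
  have := Convex.norm_image_sub_le_of_norm_hasDerivWithin_le (s := Set.Ici m)
    (f := fun u : ℝ => u ^ (-β)) (f' := fun u => (-β) * u ^ (-β - 1)) (C := β * m ^ (-β - 1))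
    (x := t) (y := s) ?_ ?_ (convex_Ici m) ht hs
  · simpa [Real.norm_eq_abs] using this
  · intro u hu
    exact (Real.hasDerivAt_rpow_const (Or.inl (lt_of_lt_of_le hm hu).ne')).hasDerivWithinAt
  · intro u hu
    have hu0 : 0 < u := lt_of_lt_of_le hm hu
    rw [norm_mul, norm_neg, Real.norm_of_nonneg hβ.le, Real.norm_of_nonneg (by positivity)]
    exact mul_le_mul_of_nonneg_left (Real.rpow_le_rpow_of_nonpos hm hu (by linarith)) hβ.le

lemma kernel_diff (n : ℕ) (α : ℝ) (hα₂ : α < 2 * n) (c : Rn n) (d : ℝ) (hd : 0 < d)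
    (x y z : Rn n) (hy : y ∈ cube n c d) (hx : x ∉ cube n c (2 * √n * d)) :
    |fracKernel n α x y z - fracKernel n α x c z| ≤
      (n - α / 2) * 4 ^ ((n : ℝ) - α / 2 + 1) * (5 / 4) * √n * d *
        ‖x - c‖ ^ (-(2 * (n : ℝ)) + α - 1) := by
  have h1 := norm_sub_le_of_mem_cube n c d hd y hy
  have h2 := lt_norm_of_notMem_cube n c d x hx
  set r := ‖x - c‖ with hr
  have hr0 : 0 < r := lt_of_le_of_lt (by positivity) h2
  have hu : ‖x - y‖ ≤ r + √n * d / 2 := by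
    have : x - y = (x - c) - (y - c) := by abel
    rw [this]; exact (norm_sub_le _ _).trans (by linarith)
  have hl : r ≤ ‖x - y‖ + √n * d / 2 := by
    have : x - c = (x - y) + (y - c) := by abel
    rw [hr, this]; exact (norm_add_le _ _).trans (by linarith)
  have hβ : 0 < (n : ℝ) - α / 2 := by linarith
  have hA : r ^ 2 / 4 ≤ ‖x - y‖ ^ 2 + ‖x - z‖ ^ 2 := by
    nlinarith [sq_nonneg ‖x - z‖]
  have hB : r ^ 2 / 4 ≤ r ^ 2 + ‖x - z‖ ^ 2 := by
    nlinarith [sq_nonneg ‖x - z‖]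
  have key := rpow_lip _ _ _ _ hβ (by positivity) hA hB
  have hd' : |‖x - y‖ ^ 2 + ‖x - z‖ ^ 2 - (r ^ 2 + ‖x - z‖ ^ 2)| ≤ (5 / 4) * √n * d * r := by
    have e : ‖x - y‖ ^ 2 + ‖x - z‖ ^ 2 - (r ^ 2 + ‖x - z‖ ^ 2)
      = (‖x - y‖ - r) * (‖x - y‖ + r) := by ring
    rw [e, abs_mul]
    have a1 : |‖x - y‖ - r| ≤ √n * d / 2 := abs_le.2 ⟨by linarith, by linarith⟩
    have a2 : |‖x - y‖ + r| ≤ 5 / 2 * r := by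
      rw [abs_of_nonneg (by positivity)]; linarith
    calc _ ≤ (√n * d / 2) * (5 / 2 * r) := by gcongr
      _ = _ := by ring
  unfold fracKernel
  rw [← hr]
  refine key.trans ((mul_le_mul_of_nonneg_left hd' (by positivity)).trans (le_of_eq ?_))
  have e1 : (r ^ 2 / 4) ^ (-((n : ℝ) - α / 2) - 1) * r =
      4 ^ ((n : ℝ) - α / 2 + 1) * r ^ (-(2 * (n : ℝ)) + α - 1) := by
    rw [Real.div_rpow (by positivity) (by norm_num), ← Real.rpow_natCast r 2, ← Real.rpow_mul hr0.le,
      div_eq_mul_inv, ← Real.rpow_neg (by norm_num)]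
    have : r ^ (-(2 * (n : ℝ)) + α - 1) = r ^ (((2 : ℕ) : ℝ) * (-((n : ℝ) - α / 2) - 1)) * r := by
      nth_rewrite 3 [← Real.rpow_one r]
      rw [← Real.rpow_add hr0]; congr 1; push_cast; ring
    rw [this]
    have : -(-((n : ℝ) - α / 2) - 1) = (n : ℝ) - α / 2 + 1 := by ring
    rw [this]; ring
  linear_combination ((n : ℝ) - α / 2) * (5 / 4) * √n * d * e1

lemma kernel_integrable (n : ℕ) (α : ℝ) (hα₂ : α < 2 * n) (c : Rn n) (d : ℝ) (hd : 0 < d)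
    (x y : Rn n) (hxy : x ≠ y) :
    IntegrableOn (fun z => fracKernel n α x y z) (cube n c d) := by
  have h0 : 0 < ‖x - y‖ := norm_pos_iff.2 (sub_ne_zero.2 hxy)
  refine Measure.integrableOn_of_bounded (M := (‖x - y‖ ^ 2) ^ (-((n : ℝ) - α / 2))) ?_ ?_ ?_
  · rw [volume_cube n c d hd]; exact ENNReal.ofReal_ne_top
  · unfold fracKernel
    apply Measurable.aestronglyMeasurable
    fun_prop
  · refine Eventually.of_forall fun z => ?_
    unfold fracKernel
    rw [Real.norm_of_nonneg (by positivity)]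
    exact Real.rpow_le_rpow_of_nonpos (by positivity) (by nlinarith [sq_nonneg ‖x - z‖]) (by linarith)

lemma abs_sign_le (t : ℝ) : |Real.sign t| ≤ 1 := by
  rcases Real.sign_apply_eq t with h | h | h <;> simp [h]

lemma measurable_realSign : Measurable Real.sign := by
  unfold Real.sign
  exact Measurable.ite measurableSet_Iio measurable_const
    (Measurable.ite measurableSet_Ioi measurable_const measurable_const)

/-- (Pointwise bound using the mean zero property, Estimate (9).) There is
`C`, independent of `b`, the cube and `x`, such that for any real-valued BMO function `b`,
any cube `Q_j` (center `y_j`, side `d_j`) and any `x ∉ 2√n Q_j`,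
`|I_α(f_j, g_j)(x)| ≤ C |Q_j|^{1/p₁'+1/p₂'+1/n} |x-y_j|^{-2n+α-1}`. -/
theorem statement13 (n : ℕ) (hn : 0 < n) (p₁ p₂ α : ℝ)
    (hp₁ : 1 < p₁) (hp₂ : 1 < p₂)
    (hα₀ : 0 < α) (hα₂ : α < 2 * n) :
    ∃ C : ℝ, ∀ b : Rn n → ℝ, LocallyIntegrable b volume →
      (∃ M : ℝ, ∀ (c : Rn n) (d : ℝ), 0 < d → osc n b c d ≤ M) →
      ∀ (yj : Rn n) (dj : ℝ), 0 < dj →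
        ∀ x : Rn n, x ∉ cube n yj (2 * Real.sqrt n * dj) →
          |Iop n α (testF n p₁ b yj dj) (testG n p₂ yj dj) x| ≤
            C * (dj ^ n) ^ (1 / conjExp p₁ + 1 / conjExp p₂ + 1 / n) *
              ‖x - yj‖ ^ (-(2 * (n : ℝ)) + α - 1) := by
  have hβ : 0 < (n : ℝ) - α / 2 := by linarith
  refine ⟨2 * ((n - α / 2) * 4 ^ ((n : ℝ) - α / 2 + 1) * (5 / 4) * √n), ?_⟩
  intro b hb _ c d hd x hx
  set D : ℝ := (n - α / 2) * 4 ^ ((n : ℝ) - α / 2 + 1) * (5 / 4) * √n with hD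
  have hD0 : 0 ≤ D := by positivity
  set Q := cube n c d with hQ
  have hQm : MeasurableSet Q := measurableSet_cube n c d
  have hvol : volume Q = ENNReal.ofReal (d ^ n) := volume_cube n c d hd
  have hreal : volume.real Q = d ^ n := by
    rw [Measure.real, hvol, ENNReal.toReal_ofReal (by positivity)]
  have hfin : volume Q ≠ ⊤ := by rw [hvol]; exact ENNReal.ofReal_ne_top
  have h2 := lt_norm_of_notMem_cube n c d x hx
  have hr0 : 0 < ‖x - c‖ := lt_of_le_of_lt (by positivity) h2
  have hxQ : ∀ y ∈ Q, x ≠ y := by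
    rintro y hy rfl
    have h1 := norm_sub_le_of_mem_cube n c d hd x hy
    linarith
  have hxc : x ≠ c := sub_ne_zero.1 (norm_pos_iff.1 hr0)
  set R := ‖x - c‖ ^ (-(2 * (n : ℝ)) + α - 1) with hR
  have hR0 : 0 ≤ R := by positivity
  set s : Rn n → ℝ := fun y => Real.sign (b y - cubeAvg n b c d) with hs
  have hsInt : IntegrableOn s Q := by
    apply Measure.integrableOn_of_bounded (M := 1) hfin
    · have : AEMeasurable b := hb.aestronglyMeasurable.aemeasurable
      exact (measurable_realSign.comp_aemeasurable (this.sub_const _)).aestronglyMeasurable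
    · exact Eventually.of_forall fun y => abs_sign_le _
  set c₀ : ℝ := ⨍ z in Q, s z with hc₀
  have hc₀' : d ^ n * c₀ = ∫ z in Q, s z := by
    rw [hc₀, setAverage_eq, hreal, smul_eq_mul, mul_inv_cancel_left₀ (by positivity)]
  have hc₀b : |c₀| ≤ 1 := by
    have h := norm_setIntegral_le_of_norm_le_const (f := s) (C := 1) (s := Q) (μ := volume)
      hfin.lt_top (fun y _ => abs_sign_le _)
    rw [← hc₀', hreal, one_mul, norm_mul, Real.norm_of_nonneg (by positivity)] at h
    have : 0 < d ^ n := by positivity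
    rw [Real.norm_eq_abs] at h
    nlinarith
  set P : ℝ := (d ^ n) ^ (-(1 / p₁)) with hP
  set P' : ℝ := (d ^ n) ^ (-(1 / p₂)) with hP'
  have hP0 : 0 ≤ P := by positivity
  have hP'0 : 0 ≤ P' := by positivity
  set H : Rn n → ℝ := fun y => ∫ z in Q, fracKernel n α x y z with hH
  have hI : Iop n α (testF n p₁ b c d) (testG n p₂ c d) x =
      P * P' * ∫ y in Q, (s y - c₀) * H y := by
    unfold Iop
    rw [← integral_const_mul, ← integral_indicator hQm]
    congr 1
    ext y
    by_cases hy : y ∈ Q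
    · rw [Set.indicator_of_mem hy]
      simp only [hH]
      rw [← mul_assoc, ← integral_const_mul, ← integral_indicator hQm]
      congr 1
      ext z
      have e1 : testF n p₁ b c d y = P * (s y - c₀) := Set.indicator_of_mem hy _
      rw [e1]
      by_cases hz : z ∈ Q
      · have e2 : testG n p₂ c d z = P' := Set.indicator_of_mem hz _
        rw [Set.indicator_of_mem hz, e2]; ring
      · have e2 : testG n p₂ c d z = 0 := Set.indicator_of_notMem hz _
        rw [Set.indicator_of_notMem hz, e2]; ring
    · rw [Set.indicator_of_notMem hy]
      have e1 : testF n p₁ b c d y = 0 := Set.indicator_of_notMem hy _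
      simp [e1]
  have hHd : ∀ y ∈ Q, |H y - H c| ≤ D * d * R * d ^ n := by
    intro y hy
    simp only [hH]
    rw [← integral_sub (kernel_integrable n α hα₂ c d hd x y (hxQ y hy))
      (kernel_integrable n α hα₂ c d hd x c hxc), ← Real.norm_eq_abs, ← hreal]
    apply norm_setIntegral_le_of_norm_le_const hfin.lt_top
    intro z _
    exact kernel_diff n α hα₂ c d hd x y z hy hx
  have hmain : |∫ y in Q, (s y - c₀) * H y| ≤ 2 * (D * d * R * d ^ n) * d ^ n := by
    by_cases hint : IntegrableOn (fun y => (s y - c₀) * H y) Q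
    · have hcint : IntegrableOn (fun y => s y - c₀) Q :=
        hsInt.sub (integrableOn_const hfin)
      have h0 : ∫ y in Q, (s y - c₀) * H c = 0 := by
        rw [integral_mul_const, integral_sub hsInt (integrableOn_const hfin), setIntegral_const,
          hreal, smul_eq_mul, hc₀']
        ring
      have e : ∫ y in Q, (s y - c₀) * H y = ∫ y in Q, (s y - c₀) * (H y - H c) := by
        simp only [mul_sub]
        rw [integral_sub hint (hcint.mul_const _), h0, sub_zero]
      rw [e, ← Real.norm_eq_abs, ← hreal]
      apply norm_setIntegral_le_of_norm_le_const hfin.lt_top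
      intro y hy
      rw [norm_mul, hreal]
      have a1 : ‖s y - c₀‖ ≤ 2 := by
        refine (norm_sub_le _ _).trans ?_
        have := abs_sign_le (b y - cubeAvg n b c d)
        simp only [Real.norm_eq_abs, hs]
        linarith
      have a2 := hHd y hy
      rw [← Real.norm_eq_abs] at a2
      exact mul_le_mul a1 a2 (norm_nonneg _) (by norm_num)
    · rw [integral_undef hint, abs_zero]; positivity
  rw [hI, abs_mul, abs_of_nonneg (mul_nonneg hP0 hP'0)]
  refine (mul_le_mul_of_nonneg_left hmain (mul_nonneg hP0 hP'0)).trans (le_of_eq ?_)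
  have hdn : 0 < d ^ n := by positivity
  have e3 : (d ^ n) ^ (1 / conjExp p₁ + 1 / conjExp p₂ + 1 / (n : ℝ)) =
      P * P' * d ^ n * d ^ n * d := by
    have e4 : (d ^ n) ^ (1 / (n : ℝ)) = d := by
      rw [one_div]; exact Real.pow_rpow_inv_natCast hd.le hn.ne'
    have e5 : 1 / conjExp p₁ + 1 / conjExp p₂ + 1 / (n : ℝ) =
        -(1 / p₁) + -(1 / p₂) + 1 + 1 + 1 / (n : ℝ) := by
      have : p₁ ≠ 0 := by linarith
      have : p₂ ≠ 0 := by linarith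
      have : p₁ - 1 ≠ 0 := by linarith
      have : p₂ - 1 ≠ 0 := by linarith
      unfold conjExp
      rw [one_div_div, one_div_div, sub_div, sub_div, div_self ‹p₁ ≠ 0›, div_self ‹p₂ ≠ 0›]
      ring
    rw [e5, Real.rpow_add hdn, e4, Real.rpow_add hdn, Real.rpow_add hdn, Real.rpow_add hdn,
      Real.rpow_one]
  rw [e3]
  ring
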